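/- Let W be an admissible Wilson loop diagram with Grassmann necklace (I_1^W, ..., I_n^W) produced by the Grassmann necklace algorithm. Then no vertex j ∈ [n] belongs to every term I_i^W of the necklace (so M(W) has no coloops), and a vertex j belongs to no term of the necklace (i.e. j is a loop of M(W)) if and only if j supports no propagator of W. -/

import Mathlib

open scoped Classical

namespace WLD

/-- A propagator of a Wilson loop diagram on the cyclically ordered vertex set
`ZMod n` (vertex `n` is identified with `0`): an unordered pair of edges, the
edge joining vertex `i` to vertex `i+1` being labelled `i`. -/
abbrev Prp (n : ℕ) := Sym2 (ZMod n)

variable (n : ℕ)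

/-- The position of `x` in the linear order `i <_i i+1 <_i ⋯ <_i i-1`. -/
def ord (i x : ZMod n) : ℕ := (x - i).val

/-- The other end of a propagator `p` having an end on the edge `e`. -/
noncomputable def otherEnd (p : Prp n) (e : ZMod n) : ZMod n :=
  if h : e ∈ p then Sym2.Mem.other h else e

/-- The vertex support `V(p) = {i, i+1, j, j+1}` of the propagator `p = (i,j)`. -/
def supp (p : Prp n) : Finset (ZMod n) :=
  Sym2.lift ⟨fun i j => {i, i + 1, j, j + 1}, fun i j => by
    ext x
    simp only [Finset.mem_insert, Finset.mem_singleton]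
    tauto⟩ p

/-- The vertex support `V(Q)` of a set of propagators. -/
def suppSet (Q : Finset (Prp n)) : Finset (ZMod n) := Q.biUnion (supp n)

/-- `Prop(U)`: the propagators of `P` supported on (a vertex of) `U`. -/
noncomputable def propsOn (P : Finset (Prp n)) (U : Finset (ZMod n)) : Finset (Prp n) :=
  P.filter fun p => (supp n p ∩ U).Nonempty

/-- Two propagators `p = (i,j)` and `q = (k,l)` cross if `i < k < j < l` cyclically. -/
def Crossing (p q : Prp n) : Prop :=
  ∃ i j k l : ZMod n, p = s(i, j) ∧ q = s(k, l) ∧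
    0 < ord n i k ∧ ord n i k < ord n i j ∧ ord n i j < ord n i l

/-- Weak admissibility of a Wilson loop diagram. -/
structure IsWeaklyAdmissible (P : Finset (Prp n)) : Prop where
  dense : ∀ Q ⊆ P, Q.Nonempty → Q.card + 3 ≤ (suppSet n Q).card
  noncross : ∀ p ∈ P, ∀ q ∈ P, ¬ Crossing n p q

/-- Admissibility of a Wilson loop diagram. -/
structure IsAdmissible (P : Finset (Prp n)) : Prop where
  card_add_four_le : P.card + 4 ≤ n
  dense : ∀ Q ⊆ P, Q.Nonempty → Q.card + 3 ≤ (suppSet n Q).card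
  noncross : ∀ p ∈ P, ∀ q ∈ P, ¬ Crossing n p q

/-- The length of a propagator `p = (i,j)`:
`min(|[i+1, j]|, |[j+1, i]|)`, the number of vertices on its smaller side. -/
def plength (p : Prp n) : ℕ :=
  Sym2.lift ⟨fun i j => min ((j - i - 1).val + 1) ((i - j - 1).val + 1),
    fun _ _ => min_comm _ _⟩ p

/-- `InsideDir n i p q` : the propagator `q = (k,l)` lies (weakly) inside the
propagator `p = (i,j)` directed from its end `i`, i.e. `i ≤_i k <_i l ≤_i j`. -/
def InsideDir (i : ZMod n) (p q : Prp n) : Prop :=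
  ∃ j k l : ZMod n, p = s(i, j) ∧ q = s(k, l) ∧
    ord n i k < ord n i l ∧ ord n i l ≤ ord n i j

/-- Sorting key measuring how far clockwise of the vertex `a` the relevant end of
a propagator supported on `a` is attached: ends on the edge `a-1` are clockwise of
ends on the edge `a`, and on a fixed edge an end is the more clockwise the larger
the propagator is (nestedness of noncrossing propagators sharing an edge). -/
noncomputable def cwKey (a : ZMod n) (p : Prp n) : ℕ :=
  if a - 1 ∈ p then n + ord n (a - 1) (otherEnd n p (a - 1))
  else ord n a (otherEnd n p a)

/-- The clockwise-most propagator of `S` supported on the vertex `a`, if any. -/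
noncomputable def pickCW (S : Finset (Prp n)) (a : ZMod n) : Option (Prp n) :=
  if h : (S.filter fun p => a ∈ supp n p).Nonempty then
    some (Classical.choose
      ((S.filter fun p => a ∈ supp n p).exists_max_image (cwKey n a) h))
  else none

/-- The Grassmann necklace algorithm started at the vertex `i`: after `t` steps,
`(gnRun n P i t).1` is the set of propagators not yet deleted, and
`(gnRun n P i t).2` records the vertex assigned to each deleted propagator.
Step `t+1` processes the vertex `i + t`: if some not-yet-deleted propagator is
supported on it, the clockwise-most such propagator is deleted and assigned
that vertex. -/
noncomputable def gnRun (P : Finset (Prp n)) (i : ZMod n) :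
    ℕ → Finset (Prp n) × (Prp n → Option (ZMod n))
  | 0 => (P, fun _ => none)
  | t + 1 =>
    match pickCW n (gnRun P i t).1 (i + (t : ZMod n)) with
    | none => gnRun P i t
    | some p => ((gnRun P i t).1.erase p,
        Function.update (gnRun P i t).2 p (some (i + (t : ZMod n))))

/-- `I_i^W(p)`: the vertex contributed by the propagator `p` to the Grassmann
necklace term `I_i^W` (as an `Option`; the algorithm makes one full circuit of
the vertex set, i.e. runs for `n` steps). -/
noncomputable def gnAssign (P : Finset (Prp n)) (i : ZMod n) (p : Prp n) :
    Option (ZMod n) :=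
  (gnRun n P i n).2 p

/-- The Grassmann necklace term `I_i^W` produced by the algorithm. -/
noncomputable def gnSet [NeZero n] (P : Finset (Prp n)) (i : ZMod n) :
    Finset (ZMod n) :=
  Finset.univ.filter fun v => ∃ p, gnAssign n P i p = some v

/-- The cyclic interval `{a, a+1, …, a + (len-1)}` in `ZMod n`. -/
def cInterval [NeZero n] (a : ZMod n) (len : ℕ) : Finset (ZMod n) :=
  Finset.univ.filter fun x => ord n a x < len

/-- A Grassmann necklace of type `(k, n)`: a cyclic sequence of `k`-element
subsets of the vertex set such that `I_{i+1} = (I_i \ {i}) ∪ {j}` for some `j`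
whenever `i ∈ I_i`, and `I_{i+1} = I_i` otherwise. -/
def IsGrassmannNecklace [NeZero n] (k : ℕ) (I : ZMod n → Finset (ZMod n)) : Prop :=
  (∀ i, (I i).card = k) ∧
  ∀ i : ZMod n,
    (i ∈ I i → ∃ j : ZMod n, I (i + 1) = insert j ((I i).erase i)) ∧
    (i ∉ I i → I (i + 1) = I i)

/-- Independence in the matroid `M(W)`: no subset `U` of `J` supports fewer
propagators than the vertices it contains. -/
def Indep (P : Finset (Prp n)) (J : Finset (ZMod n)) : Prop :=
  ∀ U ⊆ J, U.card ≤ (propsOn n P U).card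

/-- `A` is lexicographically smaller than `B` with respect to the order `<_i`:
the `<_i`-least element of the symmetric difference lies in `A`. -/
def LexLt (i : ZMod n) (A B : Finset (ZMod n)) : Prop :=
  ∃ v, v ∈ A ∧ v ∉ B ∧ ∀ w, ord n i w < ord n i v → (w ∈ A ↔ w ∈ B)

/-- A `+` is placed in the box `(a, b)` of the Le diagram with row labels `I₁`
by the necklace term `Ii`: writing `I₁ \ Ii = {a₁ > ⋯ > a_r}` and
`Ii \ I₁ = {b₁ < ⋯ < b_r}` in the `<₁` order, the plusses are in the boxes
`(a_t, b_t)`. -/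
def LePlusAt (I₁ Ii : Finset (ZMod n)) (a b : ZMod n) : Prop :=
  a ∈ I₁ \ Ii ∧ b ∈ Ii \ I₁ ∧
    ((I₁ \ Ii).filter fun x => ord n 1 a < ord n 1 x).card =
      ((Ii \ I₁).filter fun y => ord n 1 y < ord n 1 b).card

/-- The box `(a, b)` of the Le diagram of the diagram `P` contains a `+`. -/
def LePlus [NeZero n] (P : Finset (Prp n)) (a b : ZMod n) : Prop :=
  ∃ i : ZMod n, LePlusAt n (gnSet n P 1) (gnSet n P i) a b

/-- The number of `+` entries in the Le diagram of the diagram `P`. -/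
noncomputable def plusCount [NeZero n] (P : Finset (Prp n)) : ℕ :=
  (Finset.univ.filter fun ab : ZMod n × ZMod n => LePlus n P ab.1 ab.2).card

/-- The length of the row labelled `a` of the Young diagram with row labels `I₁`
(the boxes of row `a` are indexed by the column labels `b ∉ I₁` with `a <₁ b`). -/
noncomputable def rowLen [NeZero n] (I₁ : Finset (ZMod n)) (a : ZMod n) : ℕ :=
  (Finset.univ.filter fun b => b ∉ I₁ ∧ ord n 1 a < ord n 1 b).card

/-- The entry of the matrix `C(W)` in row `p` and column `q`: the indeterminate
`x_{p,q}` if `q ∈ V(p)`, and `0` otherwise. -/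
noncomputable def CW (p : Prp n) (q : ZMod n) : MvPolynomial (Prp n × ZMod n) ℝ :=
  if q ∈ supp n p then MvPolynomial.X (p, q) else 0

/-- The column paired with the row `p` in the minors determined by `I_i^W`. -/
noncomputable def colOf (P : Finset (Prp n)) (i : ZMod n) (p : Prp n) : ZMod n :=
  (gnAssign n P i p).getD i

/-- `Δ_{I_i}`: the determinant of the `k × k` minor of `C(W)` on the columns
indexed by `I_i^W`, rows and columns paired via the necklace assignment. -/
noncomputable def Delta (P : Finset (Prp n)) (i : ZMod n) :
    MvPolynomial (Prp n × ZMod n) ℝ :=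
  Matrix.det (Matrix.of fun p q : ↥P => CW n (p : Prp n) (colOf n P i (q : Prp n)))

/-- `S_i`: the propagators whose contribution changes from `I_{i-1}` to `I_i`. -/
noncomputable def Schanged (P : Finset (Prp n)) (i : ZMod n) : Finset (Prp n) :=
  P.filter fun p => gnAssign n P (i - 1) p ≠ gnAssign n P i p

/-- `r_i`: the determinant of the minor of `C(W)` with rows indexed by `S_i` and
columns indexed by `I_i(S_i)` (equal to `1` when `S_i = ∅`). -/
noncomputable def rfac (P : Finset (Prp n)) (i : ZMod n) :
    MvPolynomial (Prp n × ZMod n) ℝ :=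
  Matrix.det
    (Matrix.of fun p q : ↥(Schanged n P i) => CW n (p : Prp n) (colOf n P i (q : Prp n)))

/-- `R = ∏ᵢ rᵢ`, the polynomial produced by the algorithm. -/
noncomputable def Rpoly [NeZero n] (P : Finset (Prp n)) :
    MvPolynomial (Prp n × ZMod n) ℝ :=
  ∏ i : ZMod n, rfac n P i

/-- Position of the end of the propagator `p` along the edge `e`: larger values
attach closer to the vertex `e`, i.e. earlier in the counterclockwise ordering
of the ends of propagators along the edge `e`. -/
noncomputable def edgeKey (e : ZMod n) (p : Prp n) : ℕ := ord n e (otherEnd n p e)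

/-- The propagators of `P` with an end on the edge `e`. -/
noncomputable def onEdge (P : Finset (Prp n)) (e : ZMod n) : Finset (Prp n) :=
  P.filter fun p => e ∈ p

/-- `p` is the first propagator (`p₁`) on the edge `e` in the counterclockwise
ordering of the propagators with an end on the edge `e`. -/
def IsCcwFirst (P : Finset (Prp n)) (e : ZMod n) (p : Prp n) : Prop :=
  p ∈ onEdge n P e ∧ ∀ q ∈ onEdge n P e, edgeKey n e q ≤ edgeKey n e p

/-- `p` is the last propagator (`p_r`) on the edge `e` in the counterclockwise
ordering of the propagators with an end on the edge `e`. -/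
def IsCcwLast (P : Finset (Prp n)) (e : ZMod n) (p : Prp n) : Prop :=
  p ∈ onEdge n P e ∧ ∀ q ∈ onEdge n P e, edgeKey n e p ≤ edgeKey n e q

/-- `p` and `q` are consecutive, in this order (`p = p_j`, `q = p_{j+1}`), in the
counterclockwise ordering of the propagators with an end on the edge `e`. -/
def ConsecOnEdge (P : Finset (Prp n)) (e : ZMod n) (p q : Prp n) : Prop :=
  p ∈ onEdge n P e ∧ q ∈ onEdge n P e ∧ edgeKey n e q < edgeKey n e p ∧
    ∀ r ∈ onEdge n P e, ¬ (edgeKey n e q < edgeKey n e r ∧ edgeKey n e r < edgeKey n e p)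

/-- The factor `R_e` of the denominator `R(W)` associated to the edge `e`:
`R_e = x_{p₁,e+1} • ∏_{j=1}^{r-1} (x_{p_j,e} x_{p_{j+1},e+1} - x_{p_{j+1},e} x_{p_j,e+1}) • x_{p_r,e}`
for the counterclockwise ordering `p₁, …, p_r` of the propagators on the edge `e`
(`R_e = 1` if there are none). -/
noncomputable def Redge (P : Finset (Prp n)) (e : ZMod n) :
    MvPolynomial (Prp n × ZMod n) ℝ :=
  (∏ p ∈ (onEdge n P e).filter (IsCcwFirst n P e), MvPolynomial.X (p, e + 1)) *
    (∏ pq ∈ (P ×ˢ P).filter (fun pq => ConsecOnEdge n P e pq.1 pq.2),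
      (MvPolynomial.X (pq.1, e) * MvPolynomial.X (pq.2, e + 1) -
        MvPolynomial.X (pq.2, e) * MvPolynomial.X (pq.1, e + 1))) *
    (∏ p ∈ (onEdge n P e).filter (IsCcwLast n P e), MvPolynomial.X (p, e))

/-- The denominator `R(W) = ∏ₑ R_e` of the integrand `Ω(W)`. -/
noncomputable def RW [NeZero n] (P : Finset (Prp n)) :
    MvPolynomial (Prp n × ZMod n) ℝ :=
  ∏ e : ZMod n, Redge n P e

/-- The relabelling map associated to the removal of the vertex `i` from the
vertex set `ZMod n`: the vertex of `ZMod (n-1)` in position `t` (in the `<₁`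
order) is sent to the vertex of `ZMod n` in position `t` if `t` precedes the
position of `i`, and to the vertex in position `t+1` otherwise. -/
noncomputable def liftVert (i : ZMod n) (x : ZMod (n - 1)) : ZMod n :=
  1 + ((if ord (n - 1) 1 x < ord n 1 i then ord (n - 1) 1 x
        else ord (n - 1) 1 x + 1 : ℕ) : ZMod n)

end WLD
namespace WLD

/-- The vertex `u` of the path `0, 1, …, n` is an endpoint of one of the edges `x`, `y`. -/
def Supports (x y u : ℕ) : Prop := u = x ∨ u = x + 1 ∨ u = y ∨ u = y + 1

/-- The value of `cwKey` at the vertex in position `u` on a propagator whose ends lie on the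
edges in positions `x < y`. -/
def posKey (n x y u : ℕ) : ℕ :=
  if x + 1 = u then n + (y - x) else if y + 1 = u then n + (n - (y - x))
  else if x = u then y - x else n - (y - x)

/-- A noncrossing family of propagators, with ends on the edges in positions `lo q < hi q`, is
exhausted by the greedy deletion along the vertices `1, …, n - 1`, as soon as every nonempty
subfamily `Q` is supported on at least `|Q| + 2` of these vertices. Here `S u` is the set of
propagators that remain when the vertex `u` is reached. -/
theorem greedy_exhausts {α : Type*} (n : ℕ) (P : Finset α) (lo hi : α → ℕ) (S : ℕ → Finset α)
    (hlen : ∀ q ∈ P, lo q + 2 ≤ hi q) (hlt : ∀ q ∈ P, hi q < n)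
    (hnc : ∀ q ∈ P, ∀ r ∈ P, lo q < lo r → lo r < hi q → ¬ hi q < hi r)
    (hdense : ∀ Q ⊆ P, Q.Nonempty → Q.card + 2 ≤
      ((Finset.Ico 1 n).filter fun u => ∃ q ∈ Q, Supports (lo q) (hi q) u).card)
    (hSP : ∀ u, S u ⊆ P) (hanti : Antitone S)
    (hpick : ∀ u, 1 ≤ u → u < n → (∃ q ∈ S u, Supports (lo q) (hi q) u) →
      ∃ q ∈ S u, Supports (lo q) (hi q) u ∧ q ∉ S (u + 1) ∧
        ∀ r ∈ S u, Supports (lo r) (hi r) u →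
          posKey n (lo r) (hi r) u ≤ posKey n (lo q) (hi q) u) :
    S n = ∅ := by
  by_contra hne
  obtain ⟨p, hp⟩ := Finset.nonempty_iff_ne_empty.mpr hne
  have hpS : ∀ u ≤ n, p ∈ S u := fun u hu => hanti hu hp
  have hpP : p ∈ P := hSP _ hp
  have hpl := hlen p hpP
  have hpn := hlt p hpP
  set a := lo p with ha
  set b := hi p with hb
  -- the vertices under `p` at which nothing is deleted
  let Skip : ℕ → Prop := fun v => a + 1 < v ∧ v < b ∧ ∀ q ∈ S v, ¬ Supports (lo q) (hi q) v
  have hex : ∀ v, Skip v → ∃ s ∈ S v, lo s + 1 < v ∧ v < hi s ∧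
      ∀ q ∈ S v, lo q + 1 < v → v < hi q → lo q ≤ lo s := by
    intro v hv
    obtain ⟨s, hs, hmax⟩ := ((S v).filter fun q => lo q + 1 < v ∧ v < hi q).exists_max_image lo
      ⟨p, Finset.mem_filter.mpr ⟨hpS v (by have := hv.2.1; omega), hv.1, hv.2.1⟩⟩
    rw [Finset.mem_filter] at hs
    exact ⟨s, hs.1, hs.2.1, hs.2.2, fun q hq h1 h2 =>
      hmax q (Finset.mem_filter.mpr ⟨hq, h1, h2⟩)⟩
  have : Nonempty α := ⟨p⟩
  choose! top htopS htop1 htop2 htopmax using hex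
  -- propagators that avoid the gap between the innermost remaining arc over `v` and `v`
  let Good : ℕ → α → Prop := fun v q =>
    v < lo q ∨ (lo q ≤ lo (top v) ∧ (hi q ≤ lo (top v) ∨ v < hi q))
  let Q := P.filter fun q => a ≤ lo q ∧ hi q ≤ b ∧ ∀ v, Skip v → Good v q
  have hpQ : p ∈ Q := by
    refine Finset.mem_filter.mpr ⟨hpP, le_rfl, le_rfl, fun v hv => Or.inr ⟨?_, Or.inr hv.2.1⟩⟩
    exact htopmax v hv p (hpS v (by have := hv.2.1; omega)) hv.1 hv.2.1
  have hgood : ∀ v, Skip v → ∀ s ∈ P, Good v s → ∀ u, 1 ≤ u → u < n → Supports (lo s) (hi s) u →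
      u ≠ v → ∀ q ∈ S u, Supports (lo q) (hi q) u →
      (∀ r ∈ S u, Supports (lo r) (hi r) u →
          posKey n (lo r) (hi r) u ≤ posKey n (lo q) (hi q) u) → Good v q := by
    intro v hv s hsP hs u hu1 hun hsu huv q hq hqu hmax
    have hqP := hSP _ hq
    have hl := hlen q hqP
    have hn := hlt q hqP
    have ht1 := htop1 v hv
    have ht2 := htop2 v hv
    have htP := hSP _ (htopS v hv)
    have htn := hlt _ htP
    have hsl := hlen s hsP
    rcases lt_or_gt_of_ne huv with huv | huv
    · have hug : u ≤ lo (top v) + 1 := by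
        simp only [Good, Supports] at hs hsu; omega
      have hnc1 := hnc q hqP _ htP
      have hnc2 := hnc _ htP q hqP
      have hk := hmax (top v) (hanti huv.le (htopS v hv))
      simp only [Good, Supports, posKey] at hk hqu ⊢
      grind
    · have hqv := hv.2.2 q (hanti huv.le hq)
      have := htopmax v hv q (hanti huv.le hq)
      simp only [Good, Supports] at hqv hqu ⊢
      omega
  let V := (Finset.Ico 1 n).filter fun u => ∃ q ∈ Q, Supports (lo q) (hi q) u
  have hcard : Q.card + 2 ≤ V.card := hdense Q (Finset.filter_subset _ _) ⟨p, hpQ⟩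
  have hnext : ∀ u ∈ (V.erase a).erase (a + 1), ∃ q ∈ Q.erase p, q ∈ S u ∧ q ∉ S (u + 1) := by
    intro u hu
    rw [Finset.mem_erase, Finset.mem_erase, Finset.mem_filter, Finset.mem_Ico] at hu
    obtain ⟨hua1, hua, ⟨hu1, hun⟩, s, hsQ, hsu⟩ := hu
    obtain ⟨hsP, hsa, hsb, hsG⟩ := Finset.mem_filter.mp hsQ
    have hpu := hpS u hun.le
    have hsl := hlen s hsP
    have hns : ¬ Skip u := by
      intro h
      have := hsG u h
      have ht1 := htop1 u h
      simp only [Good, Supports] at this hsu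
      omega
    have hub : a + 1 < u ∧ u ≤ b + 1 := by simp only [Supports] at hsu; omega
    have hsome : ∃ q ∈ S u, Supports (lo q) (hi q) u := by
      by_cases hb' : u < b
      · by_contra hcon
        push Not at hcon
        exact hns ⟨hub.1, hb', hcon⟩
      · refine ⟨p, hpu, ?_⟩
        simp only [Supports]; omega
    obtain ⟨q, hq, hqu, hqd, hmax⟩ := hpick u hu1 hun hsome
    have hqP := hSP _ hq
    have hl := hlen q hqP
    have hn := hlt q hqP
    have hin : a ≤ lo q ∧ hi q ≤ b := by
      have hnc1 := hnc q hqP p hpP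
      have hnc2 := hnc p hpP q hqP
      have hk := hmax p hpu
      simp only [Supports, posKey, ← ha, ← hb] at hk hqu hnc1 hnc2
      grind
    refine ⟨q, Finset.mem_erase.mpr ⟨?_, Finset.mem_filter.mpr ⟨hqP, hin.1, hin.2, ?_⟩⟩, hq, hqd⟩
    · rintro rfl
      exact hqd (hpS _ hun)
    · intro v hv
      exact hgood v hv s hsP (hsG v hv) u hu1 hun hsu (fun h => hns (h ▸ hv)) q hq hqu hmax
  choose! f hfQ hfS hfd using hnext
  have hle : ((V.erase a).erase (a + 1)).card ≤ (Q.erase p).card := by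
    refine Finset.card_le_card_of_injOn f hfQ ?_
    intro u hu w hw huw
    by_contra hne'
    rcases lt_or_gt_of_ne hne' with h | h
    · exact hfd u hu (huw ▸ hanti h (hfS w hw))
    · exact hfd w hw (huw ▸ hanti h (hfS u hu))
  have h1 := Finset.pred_card_le_card_erase (s := V) (a := a)
  have h2 := Finset.pred_card_le_card_erase (s := V.erase a) (a := a + 1)
  have h3 := Finset.card_erase_lt_of_mem hpQ
  omega

section Algorithm

variable {n : ℕ}

theorem pickCW_eq_none {S : Finset (Prp n)} {a : ZMod n} (h : pickCW n S a = none) :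
    ∀ p ∈ S, a ∉ supp n p := by
  intro p hp ha
  unfold pickCW at h
  rw [dif_pos ⟨p, Finset.mem_filter.mpr ⟨hp, ha⟩⟩] at h
  cases h

theorem pickCW_eq_some {S : Finset (Prp n)} {a : ZMod n} {q : Prp n}
    (h : pickCW n S a = some q) :
    q ∈ S ∧ a ∈ supp n q ∧ ∀ r ∈ S, a ∈ supp n r → cwKey n a r ≤ cwKey n a q := by
  unfold pickCW at h
  split_ifs at h with hne
  obtain ⟨h1, h2⟩ := Classical.choose_spec
    ((S.filter fun p => a ∈ supp n p).exists_max_image (cwKey n a) hne)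
  rw [Option.some.injEq] at h
  rw [h] at h1 h2
  rw [Finset.mem_filter] at h1
  exact ⟨h1.1, h1.2, fun r hr har => h2 r (Finset.mem_filter.mpr ⟨hr, har⟩)⟩

theorem gnRun_succ_of_none {P : Finset (Prp n)} {i : ZMod n} {t : ℕ}
    (h : pickCW n (gnRun n P i t).1 (i + (t : ZMod n)) = none) :
    gnRun n P i (t + 1) = gnRun n P i t := by
  rw [gnRun, h]

theorem gnRun_succ_of_some {P : Finset (Prp n)} {i : ZMod n} {t : ℕ} {q : Prp n}
    (h : pickCW n (gnRun n P i t).1 (i + (t : ZMod n)) = some q) :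
    gnRun n P i (t + 1) = ((gnRun n P i t).1.erase q,
      Function.update (gnRun n P i t).2 q (some (i + (t : ZMod n)))) := by
  rw [gnRun, h]

theorem gnRun_fst_antitone (P : Finset (Prp n)) (i : ZMod n) :
    Antitone fun t => (gnRun n P i t).1 := by
  refine antitone_nat_of_succ_le fun t => ?_
  rcases h : pickCW n (gnRun n P i t).1 (i + (t : ZMod n)) with _ | q
  · rw [gnRun_succ_of_none h]
  · rw [gnRun_succ_of_some h]
    exact Finset.erase_subset _ _

theorem gnRun_fst_subset (P : Finset (Prp n)) (i : ZMod n) (t : ℕ) : (gnRun n P i t).1 ⊆ P :=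
  gnRun_fst_antitone P i (Nat.zero_le t)

theorem gnRun_pick {P : Finset (Prp n)} {i : ZMod n} {t : ℕ}
    (h : ∃ q ∈ (gnRun n P i t).1, i + (t : ZMod n) ∈ supp n q) :
    ∃ q ∈ (gnRun n P i t).1, i + (t : ZMod n) ∈ supp n q ∧ q ∉ (gnRun n P i (t + 1)).1 ∧
      ∀ r ∈ (gnRun n P i t).1, i + (t : ZMod n) ∈ supp n r →
        cwKey n (i + (t : ZMod n)) r ≤ cwKey n (i + (t : ZMod n)) q := by
  rcases hc : pickCW n (gnRun n P i t).1 (i + (t : ZMod n)) with _ | q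
  · obtain ⟨q, hq, hqs⟩ := h
    exact absurd hqs (pickCW_eq_none hc q hq)
  · obtain ⟨h1, h2, h3⟩ := pickCW_eq_some hc
    refine ⟨q, h1, h2, ?_, h3⟩
    rw [gnRun_succ_of_some hc]
    exact Finset.notMem_erase _ _

theorem exists_of_gnRun_snd {P : Finset (Prp n)} {i v : ZMod n} {p : Prp n} {t : ℕ}
    (h : (gnRun n P i t).2 p = some v) :
    ∃ s < t, v = i + (s : ZMod n) ∧ p ∈ (gnRun n P i s).1 ∧ v ∈ supp n p := by
  induction t with
  | zero => simp [gnRun] at h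
  | succ t ih =>
    rcases hc : pickCW n (gnRun n P i t).1 (i + (t : ZMod n)) with _ | q
    · rw [gnRun_succ_of_none hc] at h
      obtain ⟨s, hs, h'⟩ := ih h
      exact ⟨s, by omega, h'⟩
    · rw [gnRun_succ_of_some hc] at h
      obtain ⟨h1, h2, -⟩ := pickCW_eq_some hc
      by_cases hpq : p = q
      · subst hpq
        simp only [Function.update_self, Option.some.injEq] at h
        exact ⟨t, by omega, h.symm, h1, h ▸ h2⟩
      · simp only [Function.update_of_ne hpq] at h
        obtain ⟨s, hs, h'⟩ := ih h
        exact ⟨s, by omega, h'⟩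

theorem gnRun_snd_of_notMem {P : Finset (Prp n)} {i v : ZMod n} {p : Prp n} {s t : ℕ}
    (hst : s ≤ t) (hp : p ∉ (gnRun n P i s).1) (h : (gnRun n P i s).2 p = some v) :
    (gnRun n P i t).2 p = some v := by
  induction t, hst using Nat.le_induction with
  | base => exact h
  | succ t hst ih =>
    rcases hc : pickCW n (gnRun n P i t).1 (i + (t : ZMod n)) with _ | q
    · rw [gnRun_succ_of_none hc, ih]
    · have hpq : p ≠ q := by
        rintro rfl
        exact hp (gnRun_fst_antitone P i hst (pickCW_eq_some hc).1)
      rw [gnRun_succ_of_some hc]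
      simp only [Function.update_of_ne hpq, ih]

theorem self_mem_gnSet [NeZero n] {P : Finset (Prp n)} {j : ZMod n}
    (h : ∃ p ∈ P, j ∈ supp n p) : j ∈ gnSet n P j := by
  rcases hc : pickCW n (gnRun n P j 0).1 (j + ((0 : ℕ) : ZMod n)) with _ | q
  · obtain ⟨p, hp, hj⟩ := h
    exact absurd (by simpa using hj) (pickCW_eq_none hc p hp)
  · have hrun := gnRun_succ_of_some hc
    refine Finset.mem_filter.mpr ⟨Finset.mem_univ _, q, ?_⟩
    refine gnRun_snd_of_notMem (s := 1) (NeZero.one_le (n := n)) ?_ ?_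
    · rw [hrun]
      exact Finset.notMem_erase _ _
    · rw [hrun]
      simp

end Algorithm

section Positions

variable {n : ℕ}

theorem ord_add_natCast (j : ZMod n) {x : ℕ} (hx : x < n) : ord n j (j + (x : ZMod n)) = x := by
  rw [ord, add_sub_cancel_left, ZMod.val_natCast_of_lt hx]

theorem add_natCast_ord [NeZero n] (j x : ZMod n) : j + (ord n j x : ZMod n) = x := by
  rw [ord, ZMod.natCast_zmod_val, add_sub_cancel]

theorem add_natCast_inj (j : ZMod n) {x y : ℕ} (hx : x < n) (hy : y < n) :
    j + (x : ZMod n) = j + (y : ZMod n) ↔ x = y := by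
  refine ⟨fun h => ?_, fun h => h ▸ rfl⟩
  rw [← ord_add_natCast j hx, h, ord_add_natCast j hy]

theorem ord_add_natCast_of_le (j : ZMod n) {x y : ℕ} (hxy : x ≤ y) (hy : y < n) :
    ord n (j + (x : ZMod n)) (j + (y : ZMod n)) = y - x := by
  rw [ord, add_sub_add_left_eq_sub, ← Nat.cast_sub hxy, ZMod.val_natCast_of_lt (by omega)]

theorem ord_add_natCast_of_lt (j : ZMod n) {x y : ℕ} (hxy : x < y) (hy : y < n) :
    ord n (j + (y : ZMod n)) (j + (x : ZMod n)) = n - (y - x) := by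
  have h : (x : ZMod n) - (y : ZMod n) = ((n - (y - x) : ℕ) : ZMod n) := by
    rw [Nat.cast_sub (by omega), Nat.cast_sub hxy.le, ZMod.natCast_self]
    ring
  rw [ord, add_sub_add_left_eq_sub, h, ZMod.val_natCast_of_lt (by omega)]

theorem otherEnd_left (x y : ZMod n) : otherEnd n s(x, y) x = y := by
  have h : x ∈ s(x, y) := Sym2.mem_mk_left x y
  rw [otherEnd, dif_pos h]
  exact Sym2.congr_right.mp (Sym2.other_spec h)

theorem exists_positions [NeZero n] (j : ZMod n) (q : Prp n) :
    ∃ x y : ℕ, x ≤ y ∧ y < n ∧ q = s(j + (x : ZMod n), j + (y : ZMod n)) := by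
  induction q using Sym2.ind with
  | _ x y =>
    have hx : ord n j x < n := ZMod.val_lt _
    have hy : ord n j y < n := ZMod.val_lt _
    rcases le_total (ord n j x) (ord n j y) with h | h
    · exact ⟨_, _, h, hy, by rw [add_natCast_ord, add_natCast_ord]⟩
    · exact ⟨_, _, h, hx, by rw [add_natCast_ord, add_natCast_ord, Sym2.eq_swap]⟩

theorem mem_supp_mk (x y v : ZMod n) :
    v ∈ supp n s(x, y) ↔ v = x ∨ v = x + 1 ∨ v = y ∨ v = y + 1 := by
  simp [supp]

theorem add_natCast_mem_supp_iff (j : ZMod n) {x y u : ℕ} (hxy : x < y) (hy : y < n)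
    (hu : 1 ≤ u) (hun : u < n) :
    j + (u : ZMod n) ∈ supp n s(j + (x : ZMod n), j + (y : ZMod n)) ↔ Supports x y u := by
  have hs : j + (y : ZMod n) + 1 = j + ((y + 1 : ℕ) : ZMod n) := by push_cast; ring
  have hs' : j + (x : ZMod n) + 1 = j + ((x + 1 : ℕ) : ZMod n) := by push_cast; ring
  rw [mem_supp_mk, hs, hs', add_natCast_inj j hun (by omega), add_natCast_inj j hun (by omega),
    add_natCast_inj j hun hy, Supports]
  rcases (show y + 1 < n ∨ y + 1 = n by omega) with h | h
  · rw [add_natCast_inj j hun h]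
  · have h0 : j + ((y + 1 : ℕ) : ZMod n) = j + ((0 : ℕ) : ZMod n) := by
      rw [h, ZMod.natCast_self, Nat.cast_zero]
    rw [h0, add_natCast_inj j hun (by omega)]
    omega

theorem cwKey_eq_posKey (j : ZMod n) {x y u : ℕ} (hxy : x < y) (hy : y < n)
    (hu : 1 ≤ u) (hun : u < n) (hs : Supports x y u) :
    cwKey n (j + (u : ZMod n)) s(j + (x : ZMod n), j + (y : ZMod n)) = posKey n x y u := by
  have hpred : j + (u : ZMod n) - 1 = j + ((u - 1 : ℕ) : ZMod n) := by
    rw [Nat.cast_sub hu, Nat.cast_one]; ring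
  have hmem : j + ((u - 1 : ℕ) : ZMod n) ∈ s(j + (x : ZMod n), j + (y : ZMod n)) ↔
      u - 1 = x ∨ u - 1 = y := by
    rw [Sym2.mem_iff, add_natCast_inj j (by omega) (by omega), add_natCast_inj j (by omega) hy]
  rw [cwKey, hpred, posKey]
  rcases (show u - 1 = x ∨ u - 1 = y ∨ (u - 1 ≠ x ∧ u - 1 ≠ y) by omega) with h | h | ⟨h, h'⟩
  · rw [if_pos (hmem.mpr (Or.inl h)), if_pos (by omega), h, otherEnd_left,
      ord_add_natCast_of_le j hxy.le hy]
  · rw [if_pos (hmem.mpr (Or.inr h)), if_neg (by omega), if_pos (by omega), h, Sym2.eq_swap, otherEnd_left,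
      ord_add_natCast_of_lt j hxy hy]
  · rw [if_neg (by rw [hmem]; omega), if_neg (by omega), if_neg (by omega)]
    rcases (show u = x ∨ u = y by simp only [Supports] at hs; omega) with rfl | rfl
    · rw [if_pos rfl, otherEnd_left, ord_add_natCast_of_le j hxy.le hy]
    · rw [if_neg (by omega), Sym2.eq_swap, otherEnd_left, ord_add_natCast_of_lt j hxy hy]

theorem ne_of_four_le_card_supp {x y : ZMod n} (h : 4 ≤ (supp n s(x, y)).card) :
    y ≠ x ∧ y ≠ x + 1 := by
  have key : ∀ u v w : ZMod n, supp n s(x, y) ⊆ {u, v, w} → False := fun u v w hsub => by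
    have := Finset.card_le_card hsub
    have := Finset.card_le_three (a := u) (b := v) (c := w)
    omega
  refine ⟨fun hxy => key x (x + 1) x ?_, fun hxy => key x (x + 1) (x + 1 + 1) ?_⟩ <;>
  · intro v hv
    rw [mem_supp_mk, hxy] at hv
    simp only [Finset.mem_insert, Finset.mem_singleton]
    tauto

theorem gnRun_pred_fst_eq_empty [NeZero n] {P : Finset (Prp n)} (hadm : IsAdmissible n P) (j : ZMod n) :
    (gnRun n P (j + 1) (n - 1)).1 = ∅ := by
  choose lo hi hle hhi heq using exists_positions j
  have hlen : ∀ q ∈ P, lo q + 2 ≤ hi q := by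
    intro q hq
    have h4 := hadm.dense {q} (by simpa using hq) (Finset.singleton_nonempty q)
    rw [suppSet, Finset.singleton_biUnion, Finset.card_singleton, heq q] at h4
    obtain ⟨h1, h2⟩ := ne_of_four_le_card_supp h4
    have h1' : hi q ≠ lo q := fun h => h1 (by rw [h])
    have h2' : hi q ≠ lo q + 1 := fun h => h2 (by rw [h]; push_cast; ring)
    have := hle q
    omega
  have hsupp : ∀ q ∈ P, ∀ u, 1 ≤ u → u < n →
      (j + (u : ZMod n) ∈ supp n q ↔ Supports (lo q) (hi q) u) := by
    intro q hq u hu hun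
    have := hlen q hq
    conv_lhs => rw [heq q]
    exact add_natCast_mem_supp_iff j (by omega) (hhi q) hu hun
  have hkey : ∀ q ∈ P, ∀ u, 1 ≤ u → u < n → Supports (lo q) (hi q) u →
      cwKey n (j + (u : ZMod n)) q = posKey n (lo q) (hi q) u := by
    intro q hq u hu hun hs
    have := hlen q hq
    conv_lhs => rw [heq q]
    exact cwKey_eq_posKey j (by omega) (hhi q) hu hun hs
  refine greedy_exhausts n P lo hi (fun u => (gnRun n P (j + 1) (u - 1)).1) hlen
    (fun q _ => hhi q) ?_ ?_ (fun u => gnRun_fst_subset _ _ _)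
    (fun u w h => gnRun_fst_antitone P (j + 1) (Nat.sub_le_sub_right h 1)) ?_
  · intro q hq r hr h1 h2 h3
    have := hhi q
    have := hhi r
    refine hadm.noncross q hq r hr ⟨_, _, _, _, heq q, heq r, ?_, ?_, ?_⟩
    · rw [ord_add_natCast_of_le j h1.le (by omega)]
      omega
    · rw [ord_add_natCast_of_le j h1.le (by omega), ord_add_natCast_of_le j (by omega) (by omega)]
      omega
    · rw [ord_add_natCast_of_le j (by omega) (by omega),
        ord_add_natCast_of_le j (by omega) (by omega)]
      omega
  · intro Q hQ hQne
    have hd := hadm.dense Q hQ hQne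
    have hpred := Finset.pred_card_le_card_erase (s := suppSet n Q) (a := j)
    suffices ((suppSet n Q).erase j).card ≤ ((Finset.Ico 1 n).filter fun u =>
        ∃ q ∈ Q, Supports (lo q) (hi q) u).card by omega
    refine Finset.card_le_card_of_injOn (ord n j) ?_ ?_
    · intro v hv
      obtain ⟨hvj, hv⟩ := Finset.mem_erase.mp hv
      obtain ⟨q, hq, hqv⟩ := Finset.mem_biUnion.mp hv
      have hlt : ord n j v < n := ZMod.val_lt _
      have hpos : 1 ≤ ord n j v := by
        rw [Nat.one_le_iff_ne_zero]
        intro h0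
        have := add_natCast_ord j v
        rw [h0, Nat.cast_zero, add_zero] at this
        exact hvj this.symm
      refine Finset.mem_coe.mpr (Finset.mem_filter.mpr
        ⟨Finset.mem_Ico.mpr ⟨hpos, hlt⟩, q, hq, ?_⟩)
      rw [← hsupp q (hQ hq) _ hpos hlt, add_natCast_ord]
      exact hqv
    · intro v _ w _ h
      rw [← add_natCast_ord j v, h, add_natCast_ord]
  · rintro u hu hun ⟨q, hq, hqs⟩
    have hv : j + 1 + ((u - 1 : ℕ) : ZMod n) = j + (u : ZMod n) := by
      rw [Nat.cast_sub hu, Nat.cast_one]; ring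
    have hsub := gnRun_fst_subset P (j + 1) (u - 1)
    obtain ⟨q, hq, h1, h2, h3⟩ := gnRun_pick (P := P) (i := j + 1) (t := u - 1)
      ⟨q, hq, by rw [hv, hsupp q (hsub hq) u hu hun]; exact hqs⟩
    rw [hv] at h1 h3
    rw [Nat.sub_add_cancel hu] at h2
    have h1' := (hsupp q (hsub hq) u hu hun).mp h1
    refine ⟨q, hq, h1', by simpa using h2, fun r hr hrs => ?_⟩
    rw [← hkey q (hsub hq) u hu hun h1', ← hkey r (hsub hr) u hu hun hrs]
    exact h3 r hr ((hsupp r (hsub hr) u hu hun).mpr hrs)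

end Positions

/-- loops and coloops of `M(W)`.
Let `W` be an admissible Wilson loop diagram with Grassmann necklace
`(I_1^W, …, I_n^W)` produced by the Grassmann necklace algorithm.  Then no
vertex `j` belongs to every term of the necklace (so `M(W)` has no coloops),
and a vertex `j` belongs to no term of the necklace (i.e. `j` is a loop of
`M(W)`) if and only if `j` supports no propagator of `W`. -/
theorem no_coloops_and_loops_iff_nonsupporting
    (n : ℕ) [NeZero n] (P : Finset (Prp n)) (hadm : IsAdmissible n P) :
    (∀ j : ZMod n, ∃ i : ZMod n, j ∉ gnSet n P i) ∧
    (∀ j : ZMod n, (∀ i : ZMod n, j ∉ gnSet n P i) ↔ ¬ ∃ p ∈ P, j ∈ supp n p) := by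
  refine ⟨fun j => ⟨j + 1, fun hj => ?_⟩, fun j => ⟨fun h hex => h j (self_mem_gnSet hex), ?_⟩⟩
  · obtain ⟨p, hp⟩ := (Finset.mem_filter.mp hj).2
    obtain ⟨s, hs, hjs, hps, -⟩ := exists_of_gnRun_snd hp
    have hsn : s = n - 1 := by
      rcases (show s + 1 < n ∨ s + 1 = n by omega) with h | h
      · have h0 : j + ((0 : ℕ) : ZMod n) = j + ((s + 1 : ℕ) : ZMod n) := by
          rw [Nat.cast_zero, add_zero]
          push_cast
          rw [add_comm (s : ZMod n), ← add_assoc]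
          exact hjs
        rw [add_natCast_inj j (by omega) h] at h0
        omega
      · omega
    rw [hsn, gnRun_pred_fst_eq_empty hadm j] at hps
    exact Finset.notMem_empty _ hps
  · intro h i hj
    obtain ⟨p, hp⟩ := (Finset.mem_filter.mp hj).2
    obtain ⟨s, -, -, hps, hjp⟩ := exists_of_gnRun_snd hp
    exact h ⟨p, gnRun_fst_subset _ _ _ hps, hjp⟩

end WLD
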